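/- Let n, m be positive integers, let A be a real n×n matrix and B a real n×m matrix such that the pair (A,B) satisfies the Kalman condition (the n×(nm) block matrix (B, AB, …, A^{n−1}B) has rank n), let Q be a symmetric positive definite real n×n matrix, U a symmetric positive definite real m×m matrix, and let x^d ∈ ℝⁿ, u^d ∈ ℝᵐ. Then for every T > 0 and all x₀, x₁ ∈ ℝⁿ, there exists a unique pair of continuously differentiable functions x, λ : [0,T] → ℝⁿ satisfying x'(t) = A x(t) + B U⁻¹ Bᵀ λ(t) + B u^d and λ'(t) = Q x(t) − Aᵀ λ(t) − Q x^d for all t ∈ [0,T], together with the boundary conditions x(0) = x₀ and x(T) = x₁. -/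

import Mathlib

open Matrix Set

/-- If the Kalman matrix has full rank, its transpose has trivial kernel. -/
theorem eq_zero_of_kalman {n m : ℕ} (A : Matrix (Fin n) (Fin n) ℝ) (B : Matrix (Fin n) (Fin m) ℝ)
    (hK : (Matrix.of fun (i : Fin n) (p : Fin n × Fin m) =>
        (A ^ (p.1 : ℕ) * B) i p.2).rank = n)
    (v : Fin n → ℝ) (hv : ∀ k : ℕ, (A ^ k * B)ᵀ.mulVec v = 0) : v = 0 := by
  set K := Matrix.of fun (i : Fin n) (p : Fin n × Fin m) => (A ^ (p.1 : ℕ) * B) i p.2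
  have hker : LinearMap.ker (Kᵀ.mulVecLin) = ⊥ := by
    have h := LinearMap.finrank_range_add_finrank_ker (Kᵀ.mulVecLin)
    have hr : Module.finrank ℝ (LinearMap.range Kᵀ.mulVecLin) = n :=
      (Matrix.rank_transpose K).trans hK
    rw [hr, Module.finrank_fin_fun] at h
    exact Submodule.finrank_eq_zero.mp (by omega)
  have hmem : v ∈ LinearMap.ker (Kᵀ.mulVecLin) := by
    rw [LinearMap.mem_ker]
    ext p
    exact congrFun (hv p.1) p.2
  rwa [hker, Submodule.mem_bot] at hmem

theorem HasDerivWithinAt.matrix_mulVec {m n : Type*} [Fintype m] [Fintype n]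
    (M : Matrix m n ℝ) {f : ℝ → n → ℝ} {f' : n → ℝ} {s : Set ℝ} {t : ℝ}
    (h : HasDerivWithinAt f f' s t) :
    HasDerivWithinAt (fun t => M.mulVec (f t)) (M.mulVec f') s t :=
  (LinearMap.toContinuousLinearMap M.mulVecLin).hasFDerivAt.comp_hasDerivWithinAt t h

theorem HasDerivWithinAt.dotProduct {n : Type*} [Fintype n]
    {f g : ℝ → n → ℝ} {f' g' : n → ℝ} {s : Set ℝ} {t : ℝ}
    (hf : HasDerivWithinAt f f' s t) (hg : HasDerivWithinAt g g' s t) :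
    HasDerivWithinAt (fun t => f t ⬝ᵥ g t) (f' ⬝ᵥ g t + f t ⬝ᵥ g') s t := by
  simp only [_root_.dotProduct, ← Finset.sum_add_distrib]
  exact HasDerivWithinAt.fun_sum fun i _ =>
    (hasDerivWithinAt_pi.mp hf i).mul (hasDerivWithinAt_pi.mp hg i)

/-- A function vanishing on a nontrivial interval has vanishing derivative there. -/
theorem HasDerivWithinAt.eq_zero_of_Icc {E : Type*} [NormedAddCommGroup E] [NormedSpace ℝ E]
    {f : ℝ → E} {f' : E} {a b t : ℝ} (hab : a < b) (ht : t ∈ Icc a b)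
    (hf : HasDerivWithinAt f f' (Icc a b) t) (h0 : ∀ s ∈ Icc a b, f s = 0) : f' = 0 :=
  (uniqueDiffOn_Icc hab t ht).eq_deriv _ hf
    ((hasDerivWithinAt_const t (Icc a b) (0 : E)).congr h0 (h0 t ht))

/-- The homogeneous extremal system has only the trivial solution with zero boundary values. -/
theorem extremal_eq_zero {n m : ℕ}
    (A : Matrix (Fin n) (Fin n) ℝ) (B : Matrix (Fin n) (Fin m) ℝ)
    (hK : (Matrix.of fun (i : Fin n) (p : Fin n × Fin m) =>
        (A ^ (p.1 : ℕ) * B) i p.2).rank = n)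
    (Q : Matrix (Fin n) (Fin n) ℝ) (U : Matrix (Fin m) (Fin m) ℝ)
    (hQ : Q.PosDef) (hU : U.PosDef) {T : ℝ} (hT : 0 < T) {x l : ℝ → (Fin n → ℝ)}
    (hx : ∀ t ∈ Icc (0 : ℝ) T, HasDerivWithinAt x
          (A.mulVec (x t) + (B * U⁻¹ * Bᵀ).mulVec (l t)) (Icc 0 T) t)
    (hl : ∀ t ∈ Icc (0 : ℝ) T, HasDerivWithinAt l
          (Q.mulVec (x t) - Aᵀ.mulVec (l t)) (Icc 0 T) t)
    (h0 : x 0 = 0) (h1 : x T = 0) : ∀ t ∈ Icc (0 : ℝ) T, x t = 0 ∧ l t = 0 := by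
  have hQ0 : ∀ v : Fin n → ℝ, 0 ≤ v ⬝ᵥ Q.mulVec v := fun v => by
    simpa using hQ.posSemidef.dotProduct_mulVec_nonneg v
  have hU0 : ∀ v : Fin m → ℝ, 0 ≤ v ⬝ᵥ U⁻¹.mulVec v := fun v => by
    simpa using hU.inv.posSemidef.dotProduct_mulVec_nonneg v
  have hder : ∀ t ∈ Icc (0 : ℝ) T, HasDerivWithinAt (fun t => x t ⬝ᵥ l t)
      (x t ⬝ᵥ Q.mulVec (x t) + Bᵀ.mulVec (l t) ⬝ᵥ U⁻¹.mulVec (Bᵀ.mulVec (l t))) (Icc 0 T) t := by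
    intro t ht
    convert (hx t ht).dotProduct (hl t ht) using 1
    have e1 : A.mulVec (x t) ⬝ᵥ l t = x t ⬝ᵥ Aᵀ.mulVec (l t) := by
      rw [Matrix.mulVec_transpose, dotProduct_comm (x t), ← Matrix.dotProduct_mulVec,
        dotProduct_comm]
    have e2 : (B * U⁻¹ * Bᵀ).mulVec (l t) ⬝ᵥ l t
        = Bᵀ.mulVec (l t) ⬝ᵥ U⁻¹.mulVec (Bᵀ.mulVec (l t)) := by
      rw [dotProduct_comm, ← Matrix.mulVec_mulVec, ← Matrix.mulVec_mulVec,
        Matrix.dotProduct_mulVec, Matrix.mulVec_transpose]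
    rw [add_dotProduct, dotProduct_sub, e1, e2]
    ring
  have hmono : MonotoneOn (fun t => x t ⬝ᵥ l t) (Icc 0 T) := by
    refine monotoneOn_of_hasDerivWithinAt_nonneg (convex_Icc 0 T)
      (fun t ht => (hder t ht).continuousWithinAt)
      (fun t ht => (hder t (interior_subset ht)).mono interior_subset)
      fun t _ => add_nonneg (hQ0 _) (hU0 _)
  have hzero : ∀ t ∈ Icc (0 : ℝ) T, x t ⬝ᵥ l t = 0 := by
    intro t ht
    have a := hmono (left_mem_Icc.mpr hT.le) ht ht.1
    have b := hmono ht (right_mem_Icc.mpr hT.le) ht.2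
    simp only [h0, h1, zero_dotProduct] at a b
    exact le_antisymm b a
  have hboth : ∀ t ∈ Icc (0 : ℝ) T, x t = 0 ∧ Bᵀ.mulVec (l t) = 0 := by
    intro t ht
    have h := (hder t ht).eq_zero_of_Icc hT ht hzero
    have hq := hQ0 (x t)
    have hu := hU0 (Bᵀ.mulVec (l t))
    constructor
    · by_contra hne
      have := hQ.dotProduct_mulVec_pos hne
      simp only [star_trivial] at this
      linarith
    · by_contra hne
      have := hU.inv.dotProduct_mulVec_pos hne
      simp only [star_trivial] at this
      linarith
  have hpow : ∀ k : ℕ, ∀ t ∈ Icc (0 : ℝ) T, (A ^ k * B)ᵀ.mulVec (l t) = 0 := by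
    intro k
    induction k with
    | zero => simpa using fun t h h' => (hboth t ⟨h, h'⟩).2
    | succ k ih =>
      intro t ht
      have h := ((hl t ht).matrix_mulVec (A ^ k * B)ᵀ).eq_zero_of_Icc hT ht ih
      rw [(hboth t ht).1, Matrix.mulVec_zero, zero_sub, Matrix.mulVec_neg, neg_eq_zero,
        Matrix.mulVec_mulVec, ← Matrix.transpose_mul, ← Matrix.mul_assoc, ← pow_succ'] at h
      exact h
  exact fun t ht => ⟨(hboth t ht).1, eq_zero_of_kalman A B hK _ fun k => hpow k t ht⟩

/-- The exponential of a continuous linear map is the flow of the associated linear system. -/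
theorem hasDerivAt_exp_smul_apply {E : Type*} [NormedAddCommGroup E] [NormedSpace ℝ E]
    [CompleteSpace E] (L : E →L[ℝ] E) (v : E) (t : ℝ) :
    HasDerivAt (fun t : ℝ => NormedSpace.exp (t • L) v) (L (NormedSpace.exp (t • L) v)) t :=
  (hasDerivAt_exp_smul_const' (𝕂 := ℝ) L t).clm_apply (hasDerivAt_const t v) |>.congr_deriv
    (by simp)

/-- The linear system on the extended state space of triples `((x, l), s)` whose restriction to
the invariant hyperplane `s = 1` is the affine system with coefficient matrices `A, S, Q, R` and
forcing terms `b, c`. -/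
noncomputable def extendedField {n : ℕ} (A S Q R : Matrix (Fin n) (Fin n) ℝ) (b c : Fin n → ℝ) :
    ((Fin n → ℝ) × (Fin n → ℝ)) × ℝ →L[ℝ] ((Fin n → ℝ) × (Fin n → ℝ)) × ℝ :=
  LinearMap.toContinuousLinearMap
    { toFun := fun z => ((A.mulVec z.1.1 + S.mulVec z.1.2 + z.2 • b,
        Q.mulVec z.1.1 - R.mulVec z.1.2 - z.2 • c), 0)
      map_add' := fun y z => by
        simp only [Prod.fst_add, Prod.snd_add, Matrix.mulVec_add, add_smul, Prod.mk_add_mk,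
          add_zero]
        congr 2 <;> abel
      map_smul' := fun r z => by
        simp only [Prod.smul_fst, Prod.smul_snd, Matrix.mulVec_smul, smul_eq_mul, mul_smul,
          RingHom.id_apply, Prod.smul_mk, smul_add, smul_sub, mul_zero] }

theorem exists_flow {n : ℕ} (A S Q R : Matrix (Fin n) (Fin n) ℝ) (b c : Fin n → ℝ) :
    ∃ Φ : ℝ → ((Fin n → ℝ) × (Fin n → ℝ)) × ℝ →ₗ[ℝ] (Fin n → ℝ) × (Fin n → ℝ),
      ∀ z, Φ 0 z = z.1 ∧
        (∀ t, HasDerivAt (fun t => (Φ t z).1)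
          (A.mulVec (Φ t z).1 + S.mulVec (Φ t z).2 + z.2 • b) t) ∧
        (∀ t, HasDerivAt (fun t => (Φ t z).2)
          (Q.mulVec (Φ t z).1 - R.mulVec (Φ t z).2 - z.2 • c) t) := by
  set L := extendedField A S Q R b c
  refine ⟨fun t => LinearMap.fst ℝ _ _ ∘ₗ (NormedSpace.exp (t • L)).toLinearMap, fun z => ?_⟩
  have hd := hasDerivAt_exp_smul_apply L z
  have hs : ∀ t : ℝ, (NormedSpace.exp (t • L) z).2 = z.2 := by
    intro t
    have h : ∀ t : ℝ, HasDerivAt (fun t : ℝ => (NormedSpace.exp (t • L) z).2) 0 t :=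
      fun t => (hd t).snd
    have := is_const_of_deriv_eq_zero (fun t => (h t).differentiableAt) (fun t => (h t).deriv) t 0
    simpa using this
  refine ⟨by simp, fun t => ?_, fun t => ?_⟩
  · have h := (hd t).fst.fst
    rw [← hs t]
    exact h
  · have h := (hd t).fst.snd
    rw [← hs t]
    exact h

theorem stmt_16 (n m : ℕ) (hn : 0 < n) (hm : 0 < m)
    (A : Matrix (Fin n) (Fin n) ℝ) (B : Matrix (Fin n) (Fin m) ℝ)
    (hK : (Matrix.of fun (i : Fin n) (p : Fin n × Fin m) =>
        (A ^ (p.1 : ℕ) * B) i p.2).rank = n)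
    (Q : Matrix (Fin n) (Fin n) ℝ) (U : Matrix (Fin m) (Fin m) ℝ)
    (hQ : Q.PosDef) (hU : U.PosDef)
    (xd : Fin n → ℝ) (ud : Fin m → ℝ)
    (T : ℝ) (hT : 0 < T) (x₀ x₁ : Fin n → ℝ) :
    ∃ x l : ℝ → (Fin n → ℝ),
      (∀ t ∈ Icc (0 : ℝ) T, HasDerivWithinAt x
          (A.mulVec (x t) + (B * U⁻¹ * Bᵀ).mulVec (l t) + B.mulVec ud) (Icc 0 T) t) ∧
      (∀ t ∈ Icc (0 : ℝ) T, HasDerivWithinAt l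
          (Q.mulVec (x t) - Aᵀ.mulVec (l t) - Q.mulVec xd) (Icc 0 T) t) ∧
      x 0 = x₀ ∧ x T = x₁ ∧
      ∀ x' l' : ℝ → (Fin n → ℝ),
        (∀ t ∈ Icc (0 : ℝ) T, HasDerivWithinAt x'
            (A.mulVec (x' t) + (B * U⁻¹ * Bᵀ).mulVec (l' t) + B.mulVec ud) (Icc 0 T) t) →
        (∀ t ∈ Icc (0 : ℝ) T, HasDerivWithinAt l'
            (Q.mulVec (x' t) - Aᵀ.mulVec (l' t) - Q.mulVec xd) (Icc 0 T) t) →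
        x' 0 = x₀ → x' T = x₁ →
        ∀ t ∈ Icc (0 : ℝ) T, x' t = x t ∧ l' t = l t := by
  obtain ⟨Φ, hΦ⟩ := exists_flow A (B * U⁻¹ * Bᵀ) Q Aᵀ (B.mulVec ud) (Q.mulVec xd)
  let F : (Fin n → ℝ) →ₗ[ℝ] (Fin n → ℝ) :=
    LinearMap.fst ℝ _ _ ∘ₗ Φ T ∘ₗ LinearMap.inl ℝ _ _ ∘ₗ LinearMap.inr ℝ _ _
  have hF : Function.Injective F := by
    rw [← LinearMap.ker_eq_bot, LinearMap.ker_eq_bot']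
    intro v hv
    obtain ⟨hi, hx, hl⟩ := hΦ ((0, v), 0)
    have h := extremal_eq_zero A B hK Q U hQ hU hT
      (x := fun t => (Φ t ((0, v), 0)).1) (l := fun t => (Φ t ((0, v), 0)).2)
      (fun t _ => by simpa using (hx t).hasDerivWithinAt)
      (fun t _ => by simpa using (hl t).hasDerivWithinAt)
      (by simp [hi]) hv 0 (left_mem_Icc.mpr hT.le)
    simpa [hi] using h.2
  obtain ⟨v, hv⟩ := LinearMap.injective_iff_surjective.mp hF (x₁ - (Φ T ((x₀, 0), 1)).1)
  obtain ⟨hi, hx, hl⟩ := hΦ ((x₀, v), 1)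
  simp only [one_smul] at hx hl
  have hend : (Φ T ((x₀, v), 1)).1 = x₁ := by
    have hsplit : (((x₀, v), 1) : ((Fin n → ℝ) × (Fin n → ℝ)) × ℝ)
        = ((0, v), 0) + ((x₀, 0), 1) := by simp
    have hv' : (Φ T ((0, v), 0)).1 = x₁ - (Φ T ((x₀, 0), 1)).1 := hv
    rw [hsplit, map_add, Prod.fst_add, hv', sub_add_cancel]
  refine ⟨fun t => (Φ t ((x₀, v), 1)).1, fun t => (Φ t ((x₀, v), 1)).2,
    fun t _ => (hx t).hasDerivWithinAt, fun t _ => (hl t).hasDerivWithinAt,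
    by simp [hi], hend, fun x' l' hx' hl' h0 h1 t ht => ?_⟩
  have h := extremal_eq_zero A B hK Q U hQ hU hT
    (x := fun t => x' t - (Φ t ((x₀, v), 1)).1) (l := fun t => l' t - (Φ t ((x₀, v), 1)).2)
    (fun t ht => ((hx' t ht).sub (hx t).hasDerivWithinAt).congr_deriv (by
      simp only [Matrix.mulVec_sub]; abel))
    (fun t ht => ((hl' t ht).sub (hl t).hasDerivWithinAt).congr_deriv (by
      simp only [Matrix.mulVec_sub]; abel))
    (by simp [hi, h0]) (by simp [hend, h1]) t ht
  exact ⟨sub_eq_zero.mp h.1, sub_eq_zero.mp h.2⟩
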